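/- Define F(p,s) = ∫_0^∞ |𝔧₁(t)|^s t^{p-1} dt and G(p,s) = s^{-p/2} 2^{3p/2-1} Γ(p/2). Then for every p with 0 < p ≤ 1/4, F(p, 1.3) < e^{2p/17} G(p, 1.7). -/

import Mathlib

open MeasureTheory Real Set
open scoped ENNReal

/-- `𝔧₁(t) = ∑_{k=0}^∞ (-1)^k / (k! (k+1)!) (t/2)^{2k} = 2J₁(t)/t`. -/
noncomputable def jj1 (t : ℝ) : ℝ :=
  ∑' k : ℕ, ((-1 : ℝ) ^ k / ((k.factorial : ℝ) * ((k + 1).factorial : ℝ))) * (t / 2) ^ (2 * k)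

/-- `G(p,s) = s^{-p/2} 2^{3p/2-1} Γ(p/2)`. -/
noncomputable def Gfun (p s : ℝ) : ℝ :=
  s ^ (-p / 2) * 2 ^ (3 * p / 2 - 1) * Real.Gamma (p / 2)

/-- The entire function `∑ (-1)^k x^k / (k! (k+ν)!)`, equal to `x^{-ν/2} J_ν(2√x)` for `x > 0`. -/
noncomputable def besselSeries (ν : ℕ) (x : ℝ) : ℝ :=
  ∑' k : ℕ, ((-1 : ℝ) ^ k / ((k.factorial : ℝ) * ((k + ν).factorial : ℝ))) * x ^ k

/-- `J₀(t)² + J₁(t)²`. -/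
noncomputable def besselEnergy (t : ℝ) : ℝ :=
  besselSeries 0 (t ^ 2 / 4) ^ 2 + t ^ 2 / 4 * besselSeries 1 (t ^ 2 / 4) ^ 2

lemma jj1_eq_besselSeries (t : ℝ) : jj1 t = besselSeries 1 (t ^ 2 / 4) := by
  unfold jj1 besselSeries
  congr 1 with k
  rw [pow_mul]
  congr 2
  ring

lemma abs_coeff_le (ν k : ℕ) :
    |(-1 : ℝ) ^ k / ((k.factorial : ℝ) * ((k + ν).factorial : ℝ))| ≤ 1 / (k.factorial : ℝ) := by
  have h1 : (0 : ℝ) < k.factorial := by positivity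
  have h2 : (1 : ℝ) ≤ (k + ν).factorial := by
    exact_mod_cast Nat.one_le_iff_ne_zero.mpr (Nat.factorial_ne_zero _)
  rw [abs_div, abs_pow, abs_neg, abs_one, one_pow, abs_of_pos (by positivity)]
  apply one_div_le_one_div_of_le h1
  nlinarith

lemma summable_besselSeries (ν : ℕ) (x : ℝ) :
    Summable fun k : ℕ =>
      ((-1 : ℝ) ^ k / ((k.factorial : ℝ) * ((k + ν).factorial : ℝ))) * x ^ k := by
  refine Summable.of_norm_bounded (Real.summable_pow_div_factorial |x|) fun k => ?_
  rw [norm_mul, Real.norm_eq_abs, norm_pow, Real.norm_eq_abs]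
  calc _ ≤ 1 / (k.factorial : ℝ) * |x| ^ k := by
        gcongr
        exact abs_coeff_le ν k
    _ = _ := by ring

/-- Once consecutive terms at least halve, the truncation error is at most twice the first omitted
term. -/
lemma abs_besselSeries_sub_le (ν n : ℕ) {x : ℝ} (hx : 0 ≤ x)
    (hn : 2 * x ≤ ((n : ℝ) + 1) * ((n : ℝ) + 1 + ν)) :
    |besselSeries ν x - ∑ k ∈ Finset.range n,
        ((-1 : ℝ) ^ k / ((k.factorial : ℝ) * ((k + ν).factorial : ℝ))) * x ^ k|
      ≤ 2 * (x ^ n / ((n.factorial : ℝ) * ((n + ν).factorial : ℝ))) := by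
  have hb : ∀ i : ℕ, x ^ (i + n) / (((i + n).factorial : ℝ) * ((i + n + ν).factorial : ℝ))
      ≤ x ^ n / ((n.factorial : ℝ) * ((n + ν).factorial : ℝ)) * (1 / 2) ^ i := by
    intro i
    induction i with
    | zero => simp
    | succ i ih =>
      have e : x ^ (i + 1 + n) / (((i + 1 + n).factorial : ℝ) * ((i + 1 + n + ν).factorial : ℝ))
          = x ^ (i + n) / (((i + n).factorial : ℝ) * ((i + n + ν).factorial : ℝ))
            * (x / (((i : ℝ) + n + 1) * ((i : ℝ) + n + 1 + ν))) := by
        rw [show i + 1 + n = (i + n) + 1 by ring, show i + n + 1 + ν = (i + n + ν) + 1 by ring,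
          Nat.factorial_succ, Nat.factorial_succ]
        push_cast
        field_simp
        ring
      have hr : x / (((i : ℝ) + n + 1) * ((i : ℝ) + n + 1 + ν)) ≤ 1 / 2 := by
        rw [div_le_iff₀ (by positivity)]
        have : ((n : ℝ) + 1) * ((n : ℝ) + 1 + ν)
            ≤ ((i : ℝ) + n + 1) * ((i : ℝ) + n + 1 + ν) := by
          have hi : (0 : ℝ) ≤ i := by positivity
          gcongr <;> linarith
        linarith
      rw [e, pow_succ, ← mul_assoc]
      gcongr
  have hs := (summable_besselSeries ν x)
  unfold besselSeries
  rw [← hs.sum_add_tsum_nat_add n, add_sub_cancel_left]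
  have hg : HasSum (fun i : ℕ => x ^ n / ((n.factorial : ℝ) * ((n + ν).factorial : ℝ))
      * (1 / 2) ^ i) (x ^ n / ((n.factorial : ℝ) * ((n + ν).factorial : ℝ)) * 2) :=
    hasSum_geometric_two.mul_left _
  rw [mul_comm (2 : ℝ), ← Real.norm_eq_abs]
  refine tsum_of_norm_bounded hg fun i => ?_
  refine le_trans (le_of_eq ?_) (hb i)
  rw [norm_mul, norm_div, norm_pow, norm_neg, norm_one, one_pow, norm_pow, Real.norm_of_nonneg hx,
    Real.norm_of_nonneg (by positivity)]
  ring

/-- Termwise differentiation of a power series with coefficients `O(1/k!)`. -/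
lemma hasDerivAt_tsum_pow {c : ℕ → ℝ} (hc : ∀ k, |c k| ≤ 1 / (k.factorial : ℝ)) (x : ℝ) :
    HasDerivAt (fun y => ∑' k, c k * y ^ k) (∑' k : ℕ, ((k : ℝ) + 1) * c (k + 1) * x ^ k) x := by
  set R := |x| + 1
  have hu : Summable fun k : ℕ => (k : ℝ) * (1 / (k.factorial : ℝ)) * R ^ (k - 1) := by
    rw [← summable_nat_add_iff 1]
    refine (Real.summable_pow_div_factorial R).congr fun k => ?_
    rw [Nat.factorial_succ, Nat.add_sub_cancel]
    push_cast
    field_simp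
  have hx : x ∈ Metric.ball (0 : ℝ) R := by simp [R]
  have key := hasDerivAt_tsum_of_isPreconnected (g := fun k y => c k * y ^ k)
    (g' := fun k y => c k * ((k : ℝ) * y ^ (k - 1))) hu Metric.isOpen_ball
    (convex_ball (0 : ℝ) R).isPreconnected (fun k y _ => (hasDerivAt_pow k y).const_mul (c k))
    (fun k y hy => ?_) (Metric.mem_ball_self (by positivity : 0 < R))
    (summable_of_ne_finset_zero (s := {0}) fun k hk => by simp [Finset.mem_singleton.not.mp hk])
    hx
  · refine key.congr_deriv ?_
    have hs : Summable fun k : ℕ => c k * ((k : ℝ) * x ^ (k - 1)) := by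
      refine Summable.of_norm_bounded hu fun k => ?_
      rw [norm_mul, norm_mul, norm_pow, Real.norm_eq_abs, Real.norm_eq_abs, Real.norm_eq_abs,
        Nat.abs_cast]
      have : |x| ≤ R := by simp [R]
      calc _ ≤ 1 / (k.factorial : ℝ) * ((k : ℝ) * R ^ (k - 1)) := by
            gcongr
            exact hc k
        _ = _ := by ring
    rw [hs.tsum_eq_zero_add]
    simp only [Nat.cast_zero, zero_mul, mul_zero, zero_add]
    congr 1 with k
    push_cast
    ring
  · have : |y| ≤ R := by simpa using (Metric.mem_ball.mp hy).le
    rw [norm_mul, norm_mul, norm_pow, Real.norm_eq_abs, Real.norm_eq_abs, Real.norm_eq_abs,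
      Nat.abs_cast]
    calc _ ≤ 1 / (k.factorial : ℝ) * ((k : ℝ) * R ^ (k - 1)) := by
          gcongr
          exact hc k
      _ = _ := by ring

lemma hasDerivAt_besselSeries_zero (x : ℝ) :
    HasDerivAt (besselSeries 0) (-besselSeries 1 x) x := by
  have h := hasDerivAt_tsum_pow (fun k => abs_coeff_le 0 k) x
  refine (show HasDerivAt (besselSeries 0) _ x from h).congr_deriv ?_
  unfold besselSeries
  rw [← tsum_neg]
  congr 1 with k
  rw [add_zero, Nat.factorial_succ]
  push_cast
  field_simp
  ring

lemma differentiable_besselSeries (ν : ℕ) : Differentiable ℝ (besselSeries ν) := fun x =>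
  (hasDerivAt_tsum_pow (fun k => abs_coeff_le ν k) x).differentiableAt

lemma hasDerivAt_mul_besselSeries_one (x : ℝ) :
    HasDerivAt (fun y => y * besselSeries 1 y) (besselSeries 0 x) x := by
  have h := (hasDerivAt_tsum_pow (fun k => abs_coeff_le 1 k) x)
  have h2 := (hasDerivAt_id' x).mul h
  refine (show HasDerivAt (fun y => y * besselSeries 1 y) _ x from h2).congr_deriv ?_
  have hs : Summable fun k : ℕ => x ^ k * (((k : ℝ)) *
      ((-1 : ℝ) ^ k / ((k.factorial : ℝ) * ((k + 1).factorial : ℝ)))) := by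
    have := (summable_besselSeries 0 x).sub (summable_besselSeries 1 x)
    refine this.congr fun k => ?_
    rw [add_zero, Nat.factorial_succ]
    push_cast
    field_simp
    ring
  have e : x * ∑' k : ℕ, ((k : ℝ) + 1) *
      ((-1 : ℝ) ^ (k + 1) / (((k + 1).factorial : ℝ) * ((k + 1 + 1).factorial : ℝ))) * x ^ k
      = ∑' k : ℕ, x ^ k * (((k : ℝ)) *
      ((-1 : ℝ) ^ k / ((k.factorial : ℝ) * ((k + 1).factorial : ℝ)))) := by
    rw [hs.tsum_eq_zero_add, ← tsum_mul_left]
    simp only [Nat.cast_zero, zero_mul, mul_zero, zero_add]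
    congr 1 with k
    push_cast
    ring
  rw [e, one_mul, ← (summable_besselSeries 1 x).tsum_add hs]
  unfold besselSeries
  congr 1 with k
  rw [add_zero, Nat.factorial_succ]
  push_cast
  field_simp
  ring

lemma continuous_jj1 : Continuous jj1 := by
  rw [show jj1 = fun t => besselSeries 1 (t ^ 2 / 4) from funext jj1_eq_besselSeries]
  exact (differentiable_besselSeries 1).continuous.comp (by fun_prop)

lemma besselEnergy_nonneg (t : ℝ) : 0 ≤ besselEnergy t := by
  unfold besselEnergy
  positivity

lemma hasDerivAt_besselEnergy {t : ℝ} (ht : 0 < t) :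
    HasDerivAt besselEnergy (-(t / 2 * jj1 t ^ 2)) t := by
  have hx : HasDerivAt (fun s : ℝ => s ^ 2 / 4) (t / 2) t := by
    refine ((hasDerivAt_pow 2 t).div_const 4).congr_deriv ?_
    push_cast
    ring
  have h0 := (hasDerivAt_besselSeries_zero (t ^ 2 / 4)).comp t hx
  have h1 := (hasDerivAt_mul_besselSeries_one (t ^ 2 / 4)).comp t hx
  have hxne : t ^ 2 / 4 ≠ 0 := by positivity
  have h := (h0.pow 2).add ((h1.pow 2).div hx hxne)
  refine (h.congr_of_eventuallyEq ?_).congr_deriv ?_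
  · filter_upwards [lt_mem_nhds ht] with s hs
    have : s ^ 2 / 4 ≠ 0 := by positivity
    simp only [besselEnergy, Pi.add_apply, Pi.pow_apply, Pi.div_apply, Function.comp_apply]
    field_simp
  · rw [jj1_eq_besselSeries]
    simp only [Function.comp_apply, Pi.pow_apply]
    field_simp
    ring

lemma abs_jj1_rpow_mul_rpow_le {t d : ℝ} (ht : 0 < t) (hd : 0 < d) :
    |jj1 t| ^ (1.3 : ℝ) * t ^ (-(3 / 4) : ℝ)
      ≤ 0.65 / d ^ 7 * (t * jj1 t ^ 2) + 0.35 * d ^ 13 / t ^ 4 := by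
  have h := Real.geom_mean_le_arith_mean2_weighted (w₁ := 0.65) (w₂ := 0.35)
    (p₁ := |jj1 t| ^ (2 : ℝ) * t / d ^ (7 : ℝ)) (p₂ := d ^ (13 : ℝ) / t ^ (4 : ℝ))
    (by norm_num) (by norm_num) (by positivity) (by positivity) (by norm_num)
  have e : (|jj1 t| ^ (2 : ℝ) * t / d ^ (7 : ℝ)) ^ (0.65 : ℝ)
      * (d ^ (13 : ℝ) / t ^ (4 : ℝ)) ^ (0.35 : ℝ) = |jj1 t| ^ (1.3 : ℝ) * t ^ (-(3 / 4) : ℝ) := by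
    rw [Real.div_rpow (by positivity) (by positivity), Real.div_rpow (by positivity) (by positivity),
      Real.mul_rpow (by positivity) (by positivity), ← Real.rpow_mul (by positivity),
      ← Real.rpow_mul (by positivity), ← Real.rpow_mul (by positivity),
      ← Real.rpow_mul (by positivity)]
    rw [show (-(3 / 4) : ℝ) = 0.65 - 4 * 0.35 by norm_num, Real.rpow_sub ht,
      show (13 : ℝ) * 0.35 = 7 * 0.65 by norm_num, show (2 : ℝ) * 0.65 = 1.3 by norm_num]
    field_simp
  rw [e] at h
  refine h.trans (le_of_eq ?_)
  rw [show (2 : ℝ) = (2 : ℕ) by norm_num, show (7 : ℝ) = (7 : ℕ) by norm_num,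
    show (13 : ℝ) = (13 : ℕ) by norm_num, show (4 : ℝ) = (4 : ℕ) by norm_num]
  simp only [Real.rpow_natCast, sq_abs]
  ring

lemma intervalIntegrable_of_continuousOn_pos {f : ℝ → ℝ} (hf : ContinuousOn f (Ioi 0)) {a b : ℝ}
    (ha : 0 < a) (hab : a ≤ b) : IntervalIntegrable f volume a b := by
  refine (hf.mono ?_).intervalIntegrable
  rw [uIcc_of_le hab]
  exact fun x hx => ha.trans_le hx.1

lemma continuousOn_abs_jj1_rpow_mul (r : ℝ) :
    ContinuousOn (fun t => |jj1 t| ^ (1.3 : ℝ) * t ^ r) (Ioi 0) := by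
  refine ContinuousOn.mul ?_ ?_
  · exact (continuous_jj1.abs.rpow_const fun _ => Or.inr (by norm_num)).continuousOn
  · exact fun t ht => (Real.continuousAt_rpow_const t r (Or.inl (ne_of_gt ht))).continuousWithinAt

lemma integral_abs_jj1_rpow_le {a b d : ℝ} (ha : 0 < a) (hab : a ≤ b) (hd : 0 < d) :
    ∫ t in a..b, |jj1 t| ^ (1.3 : ℝ) * t ^ (-(3 / 4) : ℝ)
      ≤ 1.3 / d ^ 7 * (besselEnergy a - besselEnergy b)
        + 0.35 / 3 * d ^ 13 * (1 / a ^ 3 - 1 / b ^ 3) := by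
  have hc : ContinuousOn (fun t => 0.65 / d ^ 7 * (t * jj1 t ^ 2) + 0.35 * d ^ 13 / t ^ 4)
      (Ioi 0) := by
    have := continuous_jj1
    refine ContinuousOn.add (by fun_prop) ?_
    refine ContinuousOn.div (by fun_prop) (by fun_prop) fun t ht => ?_
    have : (0 : ℝ) < t := ht
    positivity
  have hI := intervalIntegrable_of_continuousOn_pos hc ha hab
  calc _ ≤ ∫ t in a..b, (0.65 / d ^ 7 * (t * jj1 t ^ 2) + 0.35 * d ^ 13 / t ^ 4) :=
        intervalIntegral.integral_mono_on hab
          (intervalIntegrable_of_continuousOn_pos (continuousOn_abs_jj1_rpow_mul _) ha hab) hI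
          fun t ht => abs_jj1_rpow_mul_rpow_le (ha.trans_le ht.1) hd
    _ = _ := by
        have hF : ∀ t ∈ uIcc a b, HasDerivAt
            (fun t => -(1.3 / d ^ 7) * besselEnergy t + -(0.35 / 3 * d ^ 13) * (t ^ 3)⁻¹)
            (0.65 / d ^ 7 * (t * jj1 t ^ 2) + 0.35 * d ^ 13 / t ^ 4) t := by
          intro t ht
          rw [uIcc_of_le hab] at ht
          have ht0 : 0 < t := ha.trans_le ht.1
          have h := ((hasDerivAt_besselEnergy ht0).const_mul (-(1.3 / d ^ 7))).add
            (((hasDerivAt_pow 3 t).inv (by positivity)).const_mul (-(0.35 / 3 * d ^ 13)))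
          refine h.congr_deriv ?_
          field_simp
          norm_num
          ring
        rw [intervalIntegral.integral_eq_sub_of_hasDerivAt hF hI]
        ring

lemma abs_sq_sub_sq_le {s p e : ℝ} (h : |s - p| ≤ e) : |s ^ 2 - p ^ 2| ≤ e * (2 * |p| + e) := by
  have h1 : |s + p| ≤ 2 * |p| + e := by
    calc |s + p| = |(s - p) + 2 * p| := by ring_nf
      _ ≤ |s - p| + |2 * p| := abs_add_le _ _
      _ ≤ _ := by rw [abs_mul, abs_two]; linarith
  rw [sq_sub_sq, abs_mul, mul_comm]
  exact mul_le_mul h h1 (abs_nonneg _) ((abs_nonneg _).trans h)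

lemma abs_besselEnergy_sub_le {t p q e : ℝ} (h0 : |besselSeries 0 (t ^ 2 / 4) - p| ≤ e)
    (h1 : |besselSeries 1 (t ^ 2 / 4) - q| ≤ e) :
    |besselEnergy t - (p ^ 2 + t ^ 2 / 4 * q ^ 2)|
      ≤ e * (2 * |p| + e) + t ^ 2 / 4 * (e * (2 * |q| + e)) := by
  have e1 : besselEnergy t - (p ^ 2 + t ^ 2 / 4 * q ^ 2)
      = (besselSeries 0 (t ^ 2 / 4) ^ 2 - p ^ 2)
        + t ^ 2 / 4 * (besselSeries 1 (t ^ 2 / 4) ^ 2 - q ^ 2) := by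
    unfold besselEnergy
    ring
  rw [e1]
  refine (abs_add_le _ _).trans ?_
  rw [abs_mul, abs_of_nonneg (by positivity : 0 ≤ t ^ 2 / 4)]
  have a := abs_sq_sub_sq_le h0
  have b := abs_sq_sub_sq_le h1
  gcongr

lemma abs_besselSeries_sub_le_of_sum_close (ν n : ℕ) {x p e : ℝ} (hx : 0 ≤ x)
    (hn : 2 * x ≤ ((n : ℝ) + 1) * ((n : ℝ) + 1 + ν))
    (h : |∑ k ∈ Finset.range n,
        ((-1 : ℝ) ^ k / ((k.factorial : ℝ) * ((k + ν).factorial : ℝ))) * x ^ k - p|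
      ≤ e - 2 * (x ^ n / ((n.factorial : ℝ) * ((n + ν).factorial : ℝ)))) :
    |besselSeries ν x - p| ≤ e := by
  have h1 := abs_besselSeries_sub_le ν n hx hn
  have h2 := abs_sub_le (besselSeries ν x) (∑ k ∈ Finset.range n,
        ((-1 : ℝ) ^ k / ((k.factorial : ℝ) * ((k + ν).factorial : ℝ))) * x ^ k) p
  linarith

lemma besselEnergy_two_mem : besselEnergy 2 ∈ Icc (0.382736 : ℝ) 0.382741 := by
  have h := abs_besselEnergy_sub_le (t := 2) (p := 0.22389078) (q := 0.57672481)
    (abs_besselSeries_sub_le_of_sum_close 0 9 (e := 0.00000002) (by norm_num) (by norm_num)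
      (by norm_num [Finset.sum_range_succ, Nat.factorial, abs_le]))
    (abs_besselSeries_sub_le_of_sum_close 1 9 (e := 0.00000002) (by norm_num) (by norm_num)
      (by norm_num [Finset.sum_range_succ, Nat.factorial, abs_le]))
  obtain ⟨h1, h2⟩ := abs_le.mp h
  norm_num [abs_of_pos, abs_of_neg] at h1 h2
  constructor <;> linarith

lemma besselEnergy_three_mem : besselEnergy 3 ∈ Icc (0.182586 : ℝ) 0.182591 := by
  have h := abs_besselEnergy_sub_le (t := 3) (p := -0.26005196) (q := 0.22603931)
    (abs_besselSeries_sub_le_of_sum_close 0 10 (e := 0.00000002) (by norm_num) (by norm_num)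
      (by norm_num [Finset.sum_range_succ, Nat.factorial, abs_le]))
    (abs_besselSeries_sub_le_of_sum_close 1 10 (e := 0.00000002) (by norm_num) (by norm_num)
      (by norm_num [Finset.sum_range_succ, Nat.factorial, abs_le]))
  obtain ⟨h1, h2⟩ := abs_le.mp h
  norm_num [abs_of_pos, abs_of_neg] at h1 h2
  constructor <;> linarith

lemma besselEnergy_eighteen_fifths_mem : besselEnergy (18/5) ∈ Icc (0.162594 : ℝ) 0.162599 := by
  have h := abs_besselEnergy_sub_le (t := 18/5) (p := -0.39176898) (q := 0.05303642)
    (abs_besselSeries_sub_le_of_sum_close 0 11 (e := 0.00000002) (by norm_num) (by norm_num)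
      (by norm_num [Finset.sum_range_succ, Nat.factorial, abs_le]))
    (abs_besselSeries_sub_le_of_sum_close 1 11 (e := 0.00000002) (by norm_num) (by norm_num)
      (by norm_num [Finset.sum_range_succ, Nat.factorial, abs_le]))
  obtain ⟨h1, h2⟩ := abs_le.mp h
  norm_num [abs_of_pos, abs_of_neg] at h1 h2
  constructor <;> linarith

lemma besselEnergy_twentyone_fifths_mem : besselEnergy (21/5) ∈ Icc (0.161016 : ℝ) 0.161021 := by
  have h := abs_besselEnergy_sub_le (t := 21/5) (p := -0.37655705) (q := -0.06602235)
    (abs_besselSeries_sub_le_of_sum_close 0 12 (e := 0.00000002) (by norm_num) (by norm_num)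
      (by norm_num [Finset.sum_range_succ, Nat.factorial, abs_le]))
    (abs_besselSeries_sub_le_of_sum_close 1 12 (e := 0.00000002) (by norm_num) (by norm_num)
      (by norm_num [Finset.sum_range_succ, Nat.factorial, abs_le]))
  obtain ⟨h1, h2⟩ := abs_le.mp h
  norm_num [abs_of_pos, abs_of_neg] at h1 h2
  constructor <;> linarith

lemma besselEnergy_six_mem : besselEnergy 6 ∈ Icc (0.099245 : ℝ) 0.099250 := by
  have h := abs_besselEnergy_sub_le (t := 6) (p := 0.15064526) (q := -0.09222795)
    (abs_besselSeries_sub_le_of_sum_close 0 15 (e := 0.00000002) (by norm_num) (by norm_num)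
      (by norm_num [Finset.sum_range_succ, Nat.factorial, abs_le]))
    (abs_besselSeries_sub_le_of_sum_close 1 15 (e := 0.00000002) (by norm_num) (by norm_num)
      (by norm_num [Finset.sum_range_succ, Nat.factorial, abs_le]))
  obtain ⟨h1, h2⟩ := abs_le.mp h
  norm_num [abs_of_pos, abs_of_neg] at h1 h2
  constructor <;> linarith

lemma besselEnergy_eight_mem : besselEnergy 8 ∈ Icc (0.084516 : ℝ) 0.084521 := by
  have h := abs_besselEnergy_sub_le (t := 8) (p := 0.17165081) (q := 0.05865909)
    (abs_besselSeries_sub_le_of_sum_close 0 18 (e := 0.00000002) (by norm_num) (by norm_num)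
      (by norm_num [Finset.sum_range_succ, Nat.factorial, abs_le]))
    (abs_besselSeries_sub_le_of_sum_close 1 18 (e := 0.00000002) (by norm_num) (by norm_num)
      (by norm_num [Finset.sum_range_succ, Nat.factorial, abs_le]))
  obtain ⟨h1, h2⟩ := abs_le.mp h
  norm_num [abs_of_pos, abs_of_neg] at h1 h2
  constructor <;> linarith

lemma besselEnergy_eleven_mem : besselEnergy 11 ∈ Icc (0.060557 : ℝ) 0.060562 := by
  have h := abs_besselEnergy_sub_le (t := 11) (p := -0.17119030) (q := -0.03214278)
    (abs_besselSeries_sub_le_of_sum_close 0 22 (e := 0.00000002) (by norm_num) (by norm_num)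
      (by norm_num [Finset.sum_range_succ, Nat.factorial, abs_le]))
    (abs_besselSeries_sub_le_of_sum_close 1 22 (e := 0.00000002) (by norm_num) (by norm_num)
      (by norm_num [Finset.sum_range_succ, Nat.factorial, abs_le]))
  obtain ⟨h1, h2⟩ := abs_le.mp h
  norm_num [abs_of_pos, abs_of_neg] at h1 h2
  constructor <;> linarith

lemma besselEnergy_sixteen_mem : besselEnergy 16 ∈ Icc (0.038759 : ℝ) 0.038764 := by
  have h := abs_besselEnergy_sub_le (t := 16) (p := -0.17489907) (q := 0.01129965)
    (abs_besselSeries_sub_le_of_sum_close 0 29 (e := 0.00000002) (by norm_num) (by norm_num)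
      (by norm_num [Finset.sum_range_succ, Nat.factorial, abs_le]))
    (abs_besselSeries_sub_le_of_sum_close 1 29 (e := 0.00000002) (by norm_num) (by norm_num)
      (by norm_num [Finset.sum_range_succ, Nat.factorial, abs_le]))
  obtain ⟨h1, h2⟩ := abs_le.mp h
  norm_num [abs_of_pos, abs_of_neg] at h1 h2
  constructor <;> linarith

lemma integral_abs_jj1_rpow_two_le {b : ℝ} (hb : 16 ≤ b) :
    ∫ t in (2 : ℝ)..b, |jj1 t| ^ (1.3 : ℝ) * t ^ (-(3 / 4) : ℝ) ≤ 0.24735 := by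
  have hI : ∀ u v : ℝ, 0 < u → u ≤ v →
      IntervalIntegrable (fun t => |jj1 t| ^ (1.3 : ℝ) * t ^ (-(3 / 4) : ℝ)) volume u v :=
    fun u v => intervalIntegrable_of_continuousOn_pos (continuousOn_abs_jj1_rpow_mul _)
  have c1 := integral_abs_jj1_rpow_le (a := 2) (b := 3) (d := 1.14)
    (by norm_num) (by norm_num) (by norm_num)
  have c2 := integral_abs_jj1_rpow_le (a := 3) (b := 18 / 5) (d := 1.11)
    (by norm_num) (by norm_num) (by norm_num)
  have c3 := integral_abs_jj1_rpow_le (a := 18 / 5) (b := 21 / 5) (d := 1.01)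
    (by norm_num) (by norm_num) (by norm_num)
  have c4 := integral_abs_jj1_rpow_le (a := 21 / 5) (b := 6) (d := 1.21)
    (by norm_num) (by norm_num) (by norm_num)
  have c5 := integral_abs_jj1_rpow_le (a := 6) (b := 8) (d := 1.19)
    (by norm_num) (by norm_num) (by norm_num)
  have c6 := integral_abs_jj1_rpow_le (a := 8) (b := 11) (d := 1.27)
    (by norm_num) (by norm_num) (by norm_num)
  have c7 := integral_abs_jj1_rpow_le (a := 11) (b := 16) (d := 1.32)
    (by norm_num) (by norm_num) (by norm_num)
  have c8 := integral_abs_jj1_rpow_le (a := 16) (b := b) (d := 1.41)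
    (by norm_num) hb (by norm_num)
  have hb3 : 0 ≤ 1 / b ^ 3 := by positivity
  have hE := besselEnergy_nonneg b
  rw [← intervalIntegral.integral_add_adjacent_intervals (hI 2 16 (by norm_num) (by norm_num))
      (hI 16 b (by norm_num) hb),
    ← intervalIntegral.integral_add_adjacent_intervals (hI 2 11 (by norm_num) (by norm_num))
      (hI 11 16 (by norm_num) (by norm_num)),
    ← intervalIntegral.integral_add_adjacent_intervals (hI 2 8 (by norm_num) (by norm_num))
      (hI 8 11 (by norm_num) (by norm_num)),
    ← intervalIntegral.integral_add_adjacent_intervals (hI 2 6 (by norm_num) (by norm_num))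
      (hI 6 8 (by norm_num) (by norm_num)),
    ← intervalIntegral.integral_add_adjacent_intervals
      (hI 2 (21 / 5) (by norm_num) (by norm_num)) (hI (21 / 5) 6 (by norm_num) (by norm_num)),
    ← intervalIntegral.integral_add_adjacent_intervals
      (hI 2 (18 / 5) (by norm_num) (by norm_num))
      (hI (18 / 5) (21 / 5) (by norm_num) (by norm_num)),
    ← intervalIntegral.integral_add_adjacent_intervals (hI 2 3 (by norm_num) (by norm_num))
      (hI 3 (18 / 5) (by norm_num) (by norm_num))]
  obtain ⟨l1, u1⟩ := besselEnergy_two_mem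
  obtain ⟨l2, u2⟩ := besselEnergy_three_mem
  obtain ⟨l3, u3⟩ := besselEnergy_eighteen_fifths_mem
  obtain ⟨l4, u4⟩ := besselEnergy_twentyone_fifths_mem
  obtain ⟨l5, u5⟩ := besselEnergy_six_mem
  obtain ⟨l6, u6⟩ := besselEnergy_eight_mem
  obtain ⟨l7, u7⟩ := besselEnergy_eleven_mem
  obtain ⟨l8, u8⟩ := besselEnergy_sixteen_mem
  generalize 1 / b ^ 3 = z at hb3 c8
  linarith

lemma integrableOn_abs_jj1_rpow :
    IntegrableOn (fun t => |jj1 t| ^ (1.3 : ℝ) * t ^ (-(3 / 4) : ℝ)) (Ioi 2) := by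
  refine integrableOn_Ioi_of_intervalIntegral_norm_bounded (l := Filter.atTop) (b := id) 0.24735 2
    (fun b => ?_) Filter.tendsto_id ?_
  · rcases le_total b 2 with hb | hb
    · simp [hb]
    · exact (intervalIntegrable_iff_integrableOn_Ioc_of_le hb).mp
        (intervalIntegrable_of_continuousOn_pos (continuousOn_abs_jj1_rpow_mul _) (by norm_num) hb)
  · filter_upwards [Filter.eventually_ge_atTop 16] with b hb
    refine le_trans (le_of_eq ?_) (integral_abs_jj1_rpow_two_le hb)
    refine intervalIntegral.integral_congr fun t ht => ?_
    rw [uIcc_of_le (show (2 : ℝ) ≤ id b by simp only [id]; linarith)] at ht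
    have : 0 ≤ t := by linarith [ht.1]
    exact Real.norm_of_nonneg (by positivity)

lemma integral_Ioi_abs_jj1_rpow_le :
    ∫ t in Ioi (2 : ℝ), |jj1 t| ^ (1.3 : ℝ) * t ^ (-(3 / 4) : ℝ) ≤ 0.24735 :=
  le_of_tendsto
    (intervalIntegral_tendsto_integral_Ioi 2 integrableOn_abs_jj1_rpow Filter.tendsto_id)
    (by
      filter_upwards [Filter.eventually_ge_atTop 16] with b hb
      exact integral_abs_jj1_rpow_two_le hb)

/-- An explicit function whose derivative is at most `exp (-0.168 t²) t^(-3/4)`; it comes from the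
tangent line of `u ^ (-7/8)` at `u = r ^ 8`. -/
noncomputable def gaussMinorant (r t : ℝ) : ℝ :=
  Real.exp (-(0.168 * t ^ 2)) / 2 *
    (-(15 / 8 / r ^ 7 - 7 / 8 / r ^ 15 * t ^ 2) / 0.168 + 7 / 8 / r ^ 15 / 0.168 ^ 2)

lemma tangent_le_rpow {t r : ℝ} (ht : 0 < t) (hr : 0 < r) :
    t * (15 / 8 / r ^ 7 - 7 / 8 / r ^ 15 * t ^ 2) ≤ t ^ (-(3 / 4) : ℝ) := by
  obtain ⟨s, hs, rfl⟩ : ∃ s : ℝ, 0 < s ∧ t = s ^ 4 :=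
    ⟨t ^ (1 / 4 : ℝ), by positivity, by
      rw [← Real.rpow_natCast, ← Real.rpow_mul ht.le]
      norm_num⟩
  have e : (s ^ 4) ^ (-(3 / 4) : ℝ) = 1 / s ^ 3 := by
    rw [← Real.rpow_natCast s 4, ← Real.rpow_mul hs.le,
      show ((4 : ℕ) : ℝ) * -(3 / 4) = -((3 : ℕ) : ℝ) by norm_num, Real.rpow_neg hs.le,
      Real.rpow_natCast, one_div]
  rw [e, le_div_iff₀ (by positivity)]
  have h := Real.geom_mean_le_arith_mean2_weighted (w₁ := 8 / 15) (w₂ := 7 / 15)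
    (p₁ := 1) (p₂ := (s / r) ^ 15) (by norm_num) (by norm_num) (by norm_num) (by positivity)
    (by norm_num)
  have e2 : ((s / r) ^ 15) ^ (7 / 15 : ℝ) = (s / r) ^ 7 := by
    rw [← Real.rpow_natCast (s / r) 15, ← Real.rpow_mul (by positivity),
      show ((15 : ℕ) : ℝ) * (7 / 15) = ((7 : ℕ) : ℝ) by norm_num, Real.rpow_natCast]
  rw [Real.one_rpow, one_mul, e2, div_pow, div_pow] at h
  calc _ = 15 / 8 * (s ^ 7 / r ^ 7) - 7 / 8 * (s ^ 15 / r ^ 15) := by ring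
    _ ≤ 1 := by linarith

lemma continuousOn_exp_mul_rpow (q : ℝ) :
    ContinuousOn (fun t : ℝ => Real.exp (-(0.168 * t ^ 2)) * t ^ q) (Ioi 0) := by
  refine ContinuousOn.mul (by fun_prop) ?_
  exact fun t ht => (Real.continuousAt_rpow_const t q (Or.inl (ne_of_gt ht))).continuousWithinAt

lemma sub_gaussMinorant_le {a b r : ℝ} (ha : 0 < a) (hab : a ≤ b) (hr : 0 < r) :
    gaussMinorant r b - gaussMinorant r a
      ≤ ∫ t in a..b, Real.exp (-(0.168 * t ^ 2)) * t ^ (-(3 / 4) : ℝ) := by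
  have hc : Continuous fun t : ℝ => Real.exp (-(0.168 * t ^ 2)) *
      (t * (15 / 8 / r ^ 7 - 7 / 8 / r ^ 15 * t ^ 2)) := by fun_prop
  have hF : ∀ t ∈ uIcc a b, HasDerivAt (gaussMinorant r) (Real.exp (-(0.168 * t ^ 2)) *
      (t * (15 / 8 / r ^ 7 - 7 / 8 / r ^ 15 * t ^ 2))) t := by
    intro t _
    have h1 : HasDerivAt (fun t : ℝ => Real.exp (-(0.168 * t ^ 2)) / 2)
        (Real.exp (-(0.168 * t ^ 2)) * -(0.168 * t)) t := by
      refine ((((hasDerivAt_pow 2 t).const_mul 0.168).neg.exp).div_const 2).congr_deriv ?_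
      push_cast
      simp only [Pi.neg_apply]
      ring
    have h2 : HasDerivAt (fun t : ℝ => -(15 / 8 / r ^ 7 - 7 / 8 / r ^ 15 * t ^ 2) / 0.168
        + 7 / 8 / r ^ 15 / 0.168 ^ 2) (7 / 8 / r ^ 15 * (2 * t) / 0.168) t := by
      refine (((((hasDerivAt_pow 2 t).const_mul (7 / 8 / r ^ 15)).const_sub
        (15 / 8 / r ^ 7)).neg.div_const 0.168).add_const _).congr_deriv ?_
      push_cast
      ring
    refine (h1.mul h2).congr_deriv ?_
    ring
  rw [← intervalIntegral.integral_eq_sub_of_hasDerivAt hF (hc.intervalIntegrable _ _)]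
  refine intervalIntegral.integral_mono_on hab (hc.intervalIntegrable _ _)
    (intervalIntegrable_of_continuousOn_pos (continuousOn_exp_mul_rpow _) ha hab) fun t ht => ?_
  exact mul_le_mul_of_nonneg_left (tangent_le_rpow (ha.trans_le ht.1) hr) (Real.exp_pos _).le

lemma exp_mem_Icc_of_sum {x y l u e : ℝ} (hx : |x| ≤ 1) (hy : y = 8 * x)
    (he : |x| ^ 12 * (13 / (479001600 * 12)) ≤ e) (hl0 : 0 ≤ l)
    (hl : l ≤ ∑ m ∈ Finset.range 12, x ^ m / (m.factorial : ℝ) - e)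
    (hu : ∑ m ∈ Finset.range 12, x ^ m / (m.factorial : ℝ) + e ≤ u) :
    Real.exp y ∈ Icc (l ^ 8) (u ^ 8) := by
  have h := Real.exp_bound hx (n := 12) (by norm_num)
  norm_num only [Nat.factorial] at h
  obtain ⟨h1, h2⟩ := abs_le.mp h
  rw [hy, show (8 : ℝ) = (8 : ℕ) by norm_num, Real.exp_nat_mul]
  exact ⟨pow_le_pow_left₀ hl0 (by linarith) 8, pow_le_pow_left₀ (Real.exp_pos _).le (by linarith) 8⟩

lemma exp_two_mem : Real.exp (-(0.168 * 2 ^ 2)) ∈ Icc (0.51068616 : ℝ) 0.51068621 := by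
  obtain ⟨h1, h2⟩ := exp_mem_Icc_of_sum (x := -21/250) (y := -(0.168 * 2 ^ 2)) (l := 0.919431255)
    (u := 0.919431257) (e := 0.0000000001) (by norm_num [abs_le]) (by norm_num)
    (by norm_num [abs_of_neg]) (by norm_num)
    (by norm_num [Finset.sum_range_succ, Nat.factorial])
    (by norm_num [Finset.sum_range_succ, Nat.factorial])
  exact ⟨le_trans (by norm_num) h1, le_trans h2 (by norm_num)⟩

lemma exp_twelve_fifths_mem : Real.exp (-(0.168 * (12/5) ^ 2)) ∈ Icc (0.37996351 : ℝ) 0.37996356 := by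
  obtain ⟨h1, h2⟩ := exp_mem_Icc_of_sum (x := -378/3125) (y := -(0.168 * (12/5) ^ 2)) (l := 0.886069401)
    (u := 0.886069403) (e := 0.0000000001) (by norm_num [abs_le]) (by norm_num)
    (by norm_num [abs_of_neg]) (by norm_num)
    (by norm_num [Finset.sum_range_succ, Nat.factorial])
    (by norm_num [Finset.sum_range_succ, Nat.factorial])
  exact ⟨le_trans (by norm_num) h1, le_trans h2 (by norm_num)⟩

lemma exp_fourteen_fifths_mem : Real.exp (-(0.168 * (14/5) ^ 2)) ∈ Icc (0.26790574 : ℝ) 0.26790579 := by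
  obtain ⟨h1, h2⟩ := exp_mem_Icc_of_sum (x := -1029/6250) (y := -(0.168 * (14/5) ^ 2)) (l := 0.848199000)
    (u := 0.848199002) (e := 0.0000000001) (by norm_num [abs_le]) (by norm_num)
    (by norm_num [abs_of_neg]) (by norm_num)
    (by norm_num [Finset.sum_range_succ, Nat.factorial])
    (by norm_num [Finset.sum_range_succ, Nat.factorial])
  exact ⟨le_trans (by norm_num) h1, le_trans h2 (by norm_num)⟩

lemma exp_sixteen_fifths_mem : Real.exp (-(0.168 * (16/5) ^ 2)) ∈ Icc (0.17900883 : ℝ) 0.17900888 := by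
  obtain ⟨h1, h2⟩ := exp_mem_Icc_of_sum (x := -672/3125) (y := -(0.168 * (16/5) ^ 2)) (l := 0.806509178)
    (u := 0.806509180) (e := 0.0000000001) (by norm_num [abs_le]) (by norm_num)
    (by norm_num [abs_of_neg]) (by norm_num)
    (by norm_num [Finset.sum_range_succ, Nat.factorial])
    (by norm_num [Finset.sum_range_succ, Nat.factorial])
  exact ⟨le_trans (by norm_num) h1, le_trans h2 (by norm_num)⟩

lemma exp_eighteen_fifths_mem : Real.exp (-(0.168 * (18/5) ^ 2)) ∈ Icc (0.11334940 : ℝ) 0.11334945 := by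
  obtain ⟨h1, h2⟩ := exp_mem_Icc_of_sum (x := -1701/6250) (y := -(0.168 * (18/5) ^ 2)) (l := 0.761732373)
    (u := 0.761732375) (e := 0.0000000001) (by norm_num [abs_le]) (by norm_num)
    (by norm_num [abs_of_neg]) (by norm_num)
    (by norm_num [Finset.sum_range_succ, Nat.factorial])
    (by norm_num [Finset.sum_range_succ, Nat.factorial])
  exact ⟨le_trans (by norm_num) h1, le_trans h2 (by norm_num)⟩

lemma exp_twentyone_fifths_mem : Real.exp (-(0.168 * (21/5) ^ 2)) ∈ Icc (0.05163681 : ℝ) 0.05163686 := by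
  obtain ⟨h1, h2⟩ := exp_mem_Icc_of_sum (x := -9261/25000) (y := -(0.168 * (21/5) ^ 2)) (l := 0.690430473)
    (u := 0.690430475) (e := 0.0000000001) (by norm_num [abs_le]) (by norm_num)
    (by norm_num [abs_of_neg]) (by norm_num)
    (by norm_num [Finset.sum_range_succ, Nat.factorial])
    (by norm_num [Finset.sum_range_succ, Nat.factorial])
  exact ⟨le_trans (by norm_num) h1, le_trans h2 (by norm_num)⟩

lemma exp_twentyfour_fifths_mem : Real.exp (-(0.168 * (24/5) ^ 2)) ∈ Icc (0.02084333 : ℝ) 0.02084338 := by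
  obtain ⟨h1, h2⟩ := exp_mem_Icc_of_sum (x := -1512/3125) (y := -(0.168 * (24/5) ^ 2)) (l := 0.616411819)
    (u := 0.616411821) (e := 0.0000000001) (by norm_num [abs_le]) (by norm_num)
    (by norm_num [abs_of_neg]) (by norm_num)
    (by norm_num [Finset.sum_range_succ, Nat.factorial])
    (by norm_num [Finset.sum_range_succ, Nat.factorial])
  exact ⟨le_trans (by norm_num) h1, le_trans h2 (by norm_num)⟩

lemma exp_twentyeight_fifths_mem : Real.exp (-(0.168 * (28/5) ^ 2)) ∈ Icc (0.00515141 : ℝ) 0.00515146 := by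
  obtain ⟨h1, h2⟩ := exp_mem_Icc_of_sum (x := -2058/3125) (y := -(0.168 * (28/5) ^ 2)) (l := 0.517596136)
    (u := 0.517596138) (e := 0.0000000001) (by norm_num [abs_le]) (by norm_num)
    (by norm_num [abs_of_neg]) (by norm_num)
    (by norm_num [Finset.sum_range_succ, Nat.factorial])
    (by norm_num [Finset.sum_range_succ, Nat.factorial])
  exact ⟨le_trans (by norm_num) h1, le_trans h2 (by norm_num)⟩

lemma integral_abs_jj1_rpow_lt_gaussian :
    (0.24735 : ℝ) < (∫ t in (2 : ℝ)..(21 / 5), Real.exp (-(0.168 * t ^ 2)) * t ^ (-(3 / 4) : ℝ))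
      + 0.967 * (∫ t in (21 / 5 : ℝ)..(24 / 5),
          Real.exp (-(0.168 * t ^ 2)) * t ^ (-(3 / 4) : ℝ))
      + 0.93 * (∫ t in (24 / 5 : ℝ)..(28 / 5),
          Real.exp (-(0.168 * t ^ 2)) * t ^ (-(3 / 4) : ℝ)) := by
  have hI : ∀ u v : ℝ, 0 < u → u ≤ v →
      IntervalIntegrable (fun t => Real.exp (-(0.168 * t ^ 2)) * t ^ (-(3 / 4) : ℝ)) volume u v :=
    fun u v => intervalIntegrable_of_continuousOn_pos (continuousOn_exp_mul_rpow _)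
  have c1 := sub_gaussMinorant_le (a := 2) (b := 12 / 5) (r := 1.22)
    (by norm_num) (by norm_num) (by norm_num)
  have c2 := sub_gaussMinorant_le (a := 12 / 5) (b := 14 / 5) (r := 1.27)
    (by norm_num) (by norm_num) (by norm_num)
  have c3 := sub_gaussMinorant_le (a := 14 / 5) (b := 16 / 5) (r := 1.32)
    (by norm_num) (by norm_num) (by norm_num)
  have c4 := sub_gaussMinorant_le (a := 16 / 5) (b := 18 / 5) (r := 1.36)
    (by norm_num) (by norm_num) (by norm_num)
  have c5 := sub_gaussMinorant_le (a := 18 / 5) (b := 21 / 5) (r := 1.4)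
    (by norm_num) (by norm_num) (by norm_num)
  have c6 := sub_gaussMinorant_le (a := 21 / 5) (b := 24 / 5) (r := 1.45)
    (by norm_num) (by norm_num) (by norm_num)
  have c7 := sub_gaussMinorant_le (a := 24 / 5) (b := 28 / 5) (r := 1.5)
    (by norm_num) (by norm_num) (by norm_num)
  rw [← intervalIntegral.integral_add_adjacent_intervals
      (hI 2 (18 / 5) (by norm_num) (by norm_num))
      (hI (18 / 5) (21 / 5) (by norm_num) (by norm_num)),
    ← intervalIntegral.integral_add_adjacent_intervals
      (hI 2 (16 / 5) (by norm_num) (by norm_num))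
      (hI (16 / 5) (18 / 5) (by norm_num) (by norm_num)),
    ← intervalIntegral.integral_add_adjacent_intervals
      (hI 2 (14 / 5) (by norm_num) (by norm_num))
      (hI (14 / 5) (16 / 5) (by norm_num) (by norm_num)),
    ← intervalIntegral.integral_add_adjacent_intervals
      (hI 2 (12 / 5) (by norm_num) (by norm_num))
      (hI (12 / 5) (14 / 5) (by norm_num) (by norm_num))]
  obtain ⟨l1, u1⟩ := exp_two_mem
  obtain ⟨l2, u2⟩ := exp_twelve_fifths_mem
  obtain ⟨l3, u3⟩ := exp_fourteen_fifths_mem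
  obtain ⟨l4, u4⟩ := exp_sixteen_fifths_mem
  obtain ⟨l5, u5⟩ := exp_eighteen_fifths_mem
  obtain ⟨l6, u6⟩ := exp_twentyone_fifths_mem
  obtain ⟨l7, u7⟩ := exp_twentyfour_fifths_mem
  obtain ⟨l8, u8⟩ := exp_twentyeight_fifths_mem
  unfold gaussMinorant at c1 c2 c3 c4 c5 c6 c7
  generalize Real.exp (-(0.168 * 2 ^ 2)) = x1 at *
  generalize Real.exp (-(0.168 * (12 / 5) ^ 2)) = x2 at *
  generalize Real.exp (-(0.168 * (14 / 5) ^ 2)) = x3 at *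
  generalize Real.exp (-(0.168 * (16 / 5) ^ 2)) = x4 at *
  generalize Real.exp (-(0.168 * (18 / 5) ^ 2)) = x5 at *
  generalize Real.exp (-(0.168 * (21 / 5) ^ 2)) = x6 at *
  generalize Real.exp (-(0.168 * (24 / 5) ^ 2)) = x7 at *
  generalize Real.exp (-(0.168 * (28 / 5) ^ 2)) = x8 at *
  norm_num only at c1 c2 c3 c4 c5 c6 c7
  linarith

/-- With `x = t² / 4` this reads `|𝔧₁(t)| ≤ exp (-t² / 8 - t⁴ / 384)`. -/
lemma abs_besselSeries_one_le_exp {x : ℝ} (h0 : 0 ≤ x) (h1 : x ≤ 1) :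
    |besselSeries 1 x| ≤ Real.exp (-(x / 2 + x ^ 2 / 24)) := by
  have a := abs_besselSeries_sub_le 1 1 h0 (by norm_num; linarith)
  have b := abs_besselSeries_sub_le 1 5 h0 (by norm_num; linarith)
  norm_num [Finset.sum_range_succ, Nat.factorial] at a b
  have a1 := (abs_le.mp a).1
  have b1 := (abs_le.mp b).2
  rw [abs_of_nonneg (by linarith)]
  have hy : |-(x / 2 + x ^ 2 / 24)| ≤ 1 := by
    rw [abs_neg, abs_of_nonneg (by positivity)]
    nlinarith
  have e := (abs_le.mp (Real.exp_bound hy (n := 5) (by norm_num))).1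
  rw [abs_neg, abs_of_nonneg (by positivity)] at e
  generalize Real.exp (-(x / 2 + x ^ 2 / 24)) = E at e ⊢
  norm_num [Finset.sum_range_succ, Nat.factorial] at e
  have hv : 0 ≤ 1 - x := by linarith
  have m : ∀ i j : ℕ, 0 ≤ x ^ 3 * x ^ i * (1 - x) ^ j := fun i j => by positivity
  linarith [m 0 7, m 1 6, m 2 5, m 3 4, m 4 3, m 5 2, m 6 1, m 7 0]

lemma abs_besselSeries_one_le_exp_mul {x : ℝ} (h0 : 1 ≤ x) (h1 : x ≤ 4.41) :
    |besselSeries 1 x| ≤ Real.exp (-(0.517 * x)) := by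
  have b := abs_besselSeries_sub_le 1 7 (x := x) (by linarith) (by norm_num; linarith)
  norm_num [Finset.sum_range_succ, Nat.factorial] at b
  obtain ⟨b1, b2⟩ := abs_le.mp b
  have e : (1 - 0.517 * x / 8) ^ 8 ≤ Real.exp (-(0.517 * x)) := by
    have h := Real.one_sub_le_exp_neg (0.517 * x / 8)
    calc _ ≤ Real.exp (-(0.517 * x / 8)) ^ 8 := pow_le_pow_left₀ (by linarith) h 8
      _ = _ := by
        rw [← Real.exp_nat_mul]
        congr 1
        push_cast
        ring
  have hu : 0 ≤ x - 1 := by linarith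
  have hv : 0 ≤ 4.41 - x := by linarith
  have m : ∀ i j : ℕ, 0 ≤ (x - 1) ^ i * (4.41 - x) ^ j := fun i j => by positivity
  refine (abs_le.mpr ⟨?_, ?_⟩).trans e
  · linarith [m 0 8, m 1 7, m 2 6, m 3 5, m 4 4, m 5 3, m 6 2, m 7 1, m 8 0]
  · linarith [m 0 8, m 1 7, m 2 6, m 3 5, m 4 4, m 5 3, m 6 2, m 7 1, m 8 0]

lemma abs_jj1_rpow_le_of_le_two {t : ℝ} (ht0 : 0 ≤ t) (ht : t ≤ 2) :
    |jj1 t| ^ (1.3 : ℝ) ≤ Real.exp (-(1.3 * (t ^ 2 / 8 + t ^ 4 / 384))) := by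
  have h := abs_besselSeries_one_le_exp (x := t ^ 2 / 4) (by positivity) (by nlinarith)
  rw [jj1_eq_besselSeries]
  refine (Real.rpow_le_rpow (abs_nonneg _) h (by norm_num)).trans (le_of_eq ?_)
  rw [← Real.exp_mul]
  congr 1
  ring

lemma abs_jj1_rpow_le_gaussian {t : ℝ} (ht0 : 2 ≤ t) (ht : t ≤ 21 / 5) :
    |jj1 t| ^ (1.3 : ℝ) ≤ Real.exp (-(0.168 * t ^ 2)) := by
  have h := abs_besselSeries_one_le_exp_mul (x := t ^ 2 / 4) (by nlinarith) (by nlinarith)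
  rw [jj1_eq_besselSeries]
  refine (Real.rpow_le_rpow (abs_nonneg _) h (by norm_num)).trans ?_
  rw [← Real.exp_mul]
  apply Real.exp_le_exp.mpr
  nlinarith

lemma sub_gaussian_le {t : ℝ} (ht0 : 0 ≤ t) (ht : t ≤ 2) :
    |jj1 t| ^ (1.3 : ℝ) - Real.exp (-(0.168 * t ^ 2))
      ≤ Real.exp (-(1.3 * (t ^ 2 / 8 + t ^ 4 / 384))) * (0.0055 * (t ^ 2 - 625 / 1024 * t ^ 4)) := by
  set y := 0.168 * t ^ 2 - 1.3 * (t ^ 2 / 8 + t ^ 4 / 384) with hy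
  have e : Real.exp (-(0.168 * t ^ 2))
      = Real.exp (-(1.3 * (t ^ 2 / 8 + t ^ 4 / 384))) * Real.exp (-y) := by
    rw [← Real.exp_add]
    congr 1
    rw [hy]
    ring
  have h1 := abs_jj1_rpow_le_of_le_two ht0 ht
  have h2 : 1 - Real.exp (-y) ≤ 0.0055 * (t ^ 2 - 625 / 1024 * t ^ 4) := by
    have h3 := Real.one_sub_le_exp_neg y
    have h4 : 0 ≤ t ^ 4 := by positivity
    linarith
  have h5 := mul_le_mul_of_nonneg_left h2
    (Real.exp_pos (-(1.3 * (t ^ 2 / 8 + t ^ 4 / 384)))).le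
  rw [e]
  linarith

lemma sub_gaussian_mul_rpow_le_of_le {t p : ℝ} (ht0 : 0 < t) (ht : t ≤ 1.28) (hp : 0 < p) :
    |jj1 t| ^ (1.3 : ℝ) * t ^ (p - 1) - Real.exp (-(0.168 * t ^ 2)) * t ^ (p - 1)
      ≤ 1.28 ^ p * (0.0055 * (t - 625 / 1024 * t ^ 3)) := by
  have h := sub_gaussian_le ht0.le (by linarith)
  have hX : 0 ≤ t - 625 / 1024 * t ^ 3 := by
    have : t * t ^ 2 ≤ t * 1.6384 := mul_le_mul_of_nonneg_left (by nlinarith) ht0.le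
    linarith
  have hK : Real.exp (-(1.3 * (t ^ 2 / 8 + t ^ 4 / 384))) ≤ 1 :=
    Real.exp_le_one_iff.mpr (by simp only [neg_nonpos]; positivity)
  have hp' : t ^ p ≤ 1.28 ^ p := Real.rpow_le_rpow ht0.le ht hp.le
  rw [Real.rpow_sub_one ht0.ne', ← sub_mul]
  calc _ ≤ (Real.exp (-(1.3 * (t ^ 2 / 8 + t ^ 4 / 384)))
        * (0.0055 * (t ^ 2 - 625 / 1024 * t ^ 4))) * (t ^ p / t) := by gcongr
    _ = (Real.exp (-(1.3 * (t ^ 2 / 8 + t ^ 4 / 384))) * t ^ p)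
        * (0.0055 * (t - 625 / 1024 * t ^ 3)) := by field_simp
    _ ≤ (1 * 1.28 ^ p) * (0.0055 * (t - 625 / 1024 * t ^ 3)) := by gcongr
    _ = _ := by ring

lemma sub_gaussian_mul_rpow_le_of_ge {t p : ℝ} (ht0 : 1.28 ≤ t) (ht : t ≤ 2) (hp : 0 < p) :
    |jj1 t| ^ (1.3 : ℝ) * t ^ (p - 1) - Real.exp (-(0.168 * t ^ 2)) * t ^ (p - 1)
      ≤ 1.28 ^ p * (0.49 * 0.0055 * (t - 625 / 1024 * t ^ 3)) := by
  have htp : 0 < t := by linarith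
  have h := sub_gaussian_le htp.le ht
  have hX : 0 ≤ 625 / 1024 * t ^ 3 - t := by
    have : t * 1.6384 ≤ t * t ^ 2 := mul_le_mul_of_nonneg_left (by nlinarith) htp.le
    linarith
  have hK : 0.49 ≤ Real.exp (-(1.3 * (t ^ 2 / 8 + t ^ 4 / 384))) := by
    have h2 : t ^ 2 ≤ 4 := by nlinarith
    have h4 : t ^ 4 ≤ 16 := by nlinarith
    have e1 : (0.49 : ℝ) ≤ Real.exp (-(0.705 / 8)) ^ 8 := by
      have e2 : (1 - 0.705 / 8 + (0.705 / 8) ^ 2 / 2 - (0.705 / 8) ^ 3 : ℝ)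
          ≤ Real.exp (-(0.705 / 8)) := by
        have hb := (abs_le.mp (Real.exp_bound (x := -(0.705 / 8)) (by norm_num [abs_of_pos])
          (n := 3) (by norm_num))).1
        rw [abs_neg, abs_of_pos (by norm_num)] at hb
        norm_num [Finset.sum_range_succ, Nat.factorial] at hb ⊢
        linarith
      exact le_trans (by norm_num) (pow_le_pow_left₀ (by norm_num) e2 8)
    rw [← Real.exp_nat_mul] at e1
    refine e1.trans (Real.exp_le_exp.mpr ?_)
    push_cast
    linarith
  have hp' : 1.28 ^ p ≤ t ^ p := Real.rpow_le_rpow (by norm_num) ht0 hp.le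
  rw [Real.rpow_sub_one htp.ne', ← sub_mul]
  have h3 : (0.49 * 1.28 ^ p) * (0.0055 * (625 / 1024 * t ^ 3 - t))
      ≤ (Real.exp (-(1.3 * (t ^ 2 / 8 + t ^ 4 / 384))) * t ^ p)
        * (0.0055 * (625 / 1024 * t ^ 3 - t)) := by gcongr
  calc _ ≤ (Real.exp (-(1.3 * (t ^ 2 / 8 + t ^ 4 / 384)))
        * (0.0055 * (t ^ 2 - 625 / 1024 * t ^ 4))) * (t ^ p / t) := by gcongr
    _ = -((Real.exp (-(1.3 * (t ^ 2 / 8 + t ^ 4 / 384))) * t ^ p)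
        * (0.0055 * (625 / 1024 * t ^ 3 - t))) := by
        field_simp
        ring
    _ ≤ -((0.49 * 1.28 ^ p) * (0.0055 * (625 / 1024 * t ^ 3 - t))) := neg_le_neg h3
    _ = _ := by ring

lemma intervalIntegrable_mul_rpow {f : ℝ → ℝ} (hf : Continuous f) {p : ℝ} (hp : 0 < p) (a b : ℝ) :
    IntervalIntegrable (fun t => f t * t ^ (p - 1)) volume a b :=
  (intervalIntegral.intervalIntegrable_rpow' (by linarith)).continuousOn_mul hf.continuousOn

lemma continuous_abs_jj1_rpow : Continuous fun t => |jj1 t| ^ (1.3 : ℝ) :=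
  continuous_jj1.abs.rpow_const fun _ => Or.inr (by norm_num)

lemma integral_poly (c a b : ℝ) :
    ∫ t in a..b, c * (t - 625 / 1024 * t ^ 3)
      = c * ((b ^ 2 - a ^ 2) / 2 - 625 / 1024 * ((b ^ 4 - a ^ 4) / 4)) := by
  rw [intervalIntegral.integral_const_mul, intervalIntegral.integral_sub
    (Continuous.intervalIntegrable (by fun_prop) _ _)
    (Continuous.intervalIntegrable (by fun_prop) _ _), intervalIntegral.integral_const_mul, integral_id,
    integral_pow]
  norm_num

lemma integral_zero_two_le {p : ℝ} (hp : 0 < p) :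
    ∫ t in (0 : ℝ)..2, |jj1 t| ^ (1.3 : ℝ) * t ^ (p - 1)
      ≤ ∫ t in (0 : ℝ)..2, Real.exp (-(0.168 * t ^ 2)) * t ^ (p - 1) := by
  have hf := fun a b => intervalIntegrable_mul_rpow continuous_abs_jj1_rpow hp a b
  have hg := fun a b => intervalIntegrable_mul_rpow
    (f := fun t => Real.exp (-(0.168 * t ^ 2))) (by fun_prop) hp a b
  rw [← sub_nonpos, ← intervalIntegral.integral_sub (hf _ _) (hg _ _),
    ← intervalIntegral.integral_add_adjacent_intervals (((hf 0 1.28).sub (hg 0 1.28)))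
      ((hf 1.28 2).sub (hg 1.28 2))]
  have h1 : ∫ t in (0 : ℝ)..1.28, (|jj1 t| ^ (1.3 : ℝ) * t ^ (p - 1)
      - Real.exp (-(0.168 * t ^ 2)) * t ^ (p - 1))
      ≤ ∫ t in (0 : ℝ)..1.28, 1.28 ^ p * (0.0055 * (t - 625 / 1024 * t ^ 3)) :=
    intervalIntegral.integral_mono_on_of_le_Ioo (by norm_num) ((hf _ _).sub (hg _ _))
      (Continuous.intervalIntegrable (by fun_prop) _ _)
      fun t ht => sub_gaussian_mul_rpow_le_of_le ht.1 ht.2.le hp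
  have h2 : ∫ t in (1.28 : ℝ)..2, (|jj1 t| ^ (1.3 : ℝ) * t ^ (p - 1)
      - Real.exp (-(0.168 * t ^ 2)) * t ^ (p - 1))
      ≤ ∫ t in (1.28 : ℝ)..2, 1.28 ^ p * (0.49 * 0.0055 * (t - 625 / 1024 * t ^ 3)) :=
    intervalIntegral.integral_mono_on (by norm_num) ((hf _ _).sub (hg _ _))
      (Continuous.intervalIntegrable (by fun_prop) _ _)
      fun t ht => sub_gaussian_mul_rpow_le_of_ge ht.1 ht.2 hp
  rw [intervalIntegral.integral_const_mul, integral_poly] at h1 h2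
  have hpos : (0 : ℝ) < 1.28 ^ p := by positivity
  refine (add_le_add h1 h2).trans ?_
  rw [← mul_add]
  exact mul_nonpos_of_nonneg_of_nonpos hpos.le (by norm_num)

lemma rpow_sub_one_eq {t : ℝ} (ht : 0 < t) (p : ℝ) :
    t ^ (p - 1) = t ^ (p - 1 / 4) * t ^ (-(3 / 4) : ℝ) := by
  rw [← Real.rpow_add ht]
  congr 1
  ring

lemma integral_two_sub_le {p : ℝ} (hp0 : 0 < p) (hp1 : p ≤ 1 / 4) :
    (∫ t in (2 : ℝ)..(21 / 5), |jj1 t| ^ (1.3 : ℝ) * t ^ (p - 1))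
        - ∫ t in (2 : ℝ)..(21 / 5), Real.exp (-(0.168 * t ^ 2)) * t ^ (p - 1)
      ≤ (21 / 5) ^ (p - 1 / 4) *
        ((∫ t in (2 : ℝ)..(21 / 5), |jj1 t| ^ (1.3 : ℝ) * t ^ (-(3 / 4) : ℝ))
        - ∫ t in (2 : ℝ)..(21 / 5), Real.exp (-(0.168 * t ^ 2)) * t ^ (-(3 / 4) : ℝ)) := by
  have hf : ∀ r : ℝ, IntervalIntegrable (fun t => |jj1 t| ^ (1.3 : ℝ) * t ^ r) volume 2 (21 / 5) :=
    fun r => intervalIntegrable_of_continuousOn_pos (continuousOn_abs_jj1_rpow_mul r)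
      (by norm_num) (by norm_num)
  have hg : ∀ r : ℝ, IntervalIntegrable (fun t => Real.exp (-(0.168 * t ^ 2)) * t ^ r)
      volume 2 (21 / 5) :=
    fun r => intervalIntegrable_of_continuousOn_pos (continuousOn_exp_mul_rpow r)
      (by norm_num) (by norm_num)
  rw [← intervalIntegral.integral_sub (hf _) (hg _), ← intervalIntegral.integral_sub (hf _) (hg _),
    ← intervalIntegral.integral_const_mul]
  refine intervalIntegral.integral_mono_on (by norm_num) ((hf _).sub (hg _))
    (((hf _).sub (hg _)).const_mul _) fun t ht => ?_
  have ht0 : 0 < t := by linarith [ht.1]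
  have h1 := abs_jj1_rpow_le_gaussian ht.1 ht.2
  have h2 : (21 / 5 : ℝ) ^ (p - 1 / 4) ≤ t ^ (p - 1 / 4) :=
    Real.rpow_le_rpow_of_nonpos ht0 ht.2 (by linarith)
  rw [rpow_sub_one_eq ht0, ← sub_mul, ← sub_mul]
  have h3 : (21 / 5 : ℝ) ^ (p - 1 / 4) *
      ((Real.exp (-(0.168 * t ^ 2)) - |jj1 t| ^ (1.3 : ℝ)) * t ^ (-(3 / 4) : ℝ))
      ≤ t ^ (p - 1 / 4) *
      ((Real.exp (-(0.168 * t ^ 2)) - |jj1 t| ^ (1.3 : ℝ)) * t ^ (-(3 / 4) : ℝ)) :=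
    mul_le_mul_of_nonneg_right h2 (mul_nonneg (sub_nonneg.mpr h1) (by positivity))
  linarith

lemma abs_jj1_rpow_mul_rpow_sub_one_le {a t p : ℝ} (ha : 0 < a) (ht : a ≤ t) (hp1 : p ≤ 1 / 4) :
    |jj1 t| ^ (1.3 : ℝ) * t ^ (p - 1)
      ≤ a ^ (p - 1 / 4) * (|jj1 t| ^ (1.3 : ℝ) * t ^ (-(3 / 4) : ℝ)) := by
  have ht0 : 0 < t := ha.trans_le ht
  have h2 : t ^ (p - 1 / 4) ≤ a ^ (p - 1 / 4) :=
    Real.rpow_le_rpow_of_nonpos ha ht (by linarith)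
  rw [rpow_sub_one_eq ht0]
  calc _ = t ^ (p - 1 / 4) * (|jj1 t| ^ (1.3 : ℝ) * t ^ (-(3 / 4) : ℝ)) := by ring
    _ ≤ _ := by gcongr

lemma integrableOn_Ioi_two_abs_jj1_rpow_mul {p : ℝ} (hp1 : p ≤ 1 / 4) :
    IntegrableOn (fun t => |jj1 t| ^ (1.3 : ℝ) * t ^ (p - 1)) (Ioi 2) := by
  refine Integrable.mono' (integrableOn_abs_jj1_rpow.const_mul (2 ^ (p - 1 / 4)))
    (((continuousOn_abs_jj1_rpow_mul (p - 1)).mono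
      (Ioi_subset_Ioi (by norm_num))).aestronglyMeasurable measurableSet_Ioi) ?_
  refine (ae_restrict_iff' measurableSet_Ioi).mpr (Filter.Eventually.of_forall fun t ht => ?_)
  have ht' : (2 : ℝ) ≤ t := le_of_lt ht
  rw [Real.norm_of_nonneg (by positivity)]
  exact abs_jj1_rpow_mul_rpow_sub_one_le (by norm_num) ht' hp1

lemma integral_Ioi_abs_jj1_rpow_mul_le {p : ℝ} (hp1 : p ≤ 1 / 4) :
    ∫ t in Ioi (21 / 5 : ℝ), |jj1 t| ^ (1.3 : ℝ) * t ^ (p - 1)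
      ≤ (21 / 5) ^ (p - 1 / 4)
        * ∫ t in Ioi (21 / 5 : ℝ), |jj1 t| ^ (1.3 : ℝ) * t ^ (-(3 / 4) : ℝ) := by
  have hsub : Ioi (21 / 5 : ℝ) ⊆ Ioi 2 := Ioi_subset_Ioi (by norm_num)
  rw [← integral_const_mul]
  exact setIntegral_mono_on ((integrableOn_Ioi_two_abs_jj1_rpow_mul hp1).mono_set hsub)
    ((integrableOn_abs_jj1_rpow.mono_set hsub).const_mul _) measurableSet_Ioi
    fun t ht => abs_jj1_rpow_mul_rpow_sub_one_le (by norm_num) (le_of_lt ht) hp1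

lemma mul_integral_gaussian_le {a b c p : ℝ} (ha : 21 / 5 ≤ a) (hab : a ≤ b) (hc : 0 ≤ c)
    (hcb : b * c ^ 4 ≤ 21 / 5) (hp0 : 0 < p) (hp1 : p ≤ 1 / 4) :
    (21 / 5) ^ (p - 1 / 4) *
        (c * ∫ t in a..b, Real.exp (-(0.168 * t ^ 2)) * t ^ (-(3 / 4) : ℝ))
      ≤ ∫ t in a..b, Real.exp (-(0.168 * t ^ 2)) * t ^ (p - 1) := by
  have ha0 : 0 < a := by linarith
  have hb0 : 0 < b := by linarith
  have hg : ∀ r : ℝ, IntervalIntegrable (fun t => Real.exp (-(0.168 * t ^ 2)) * t ^ r)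
      volume a b :=
    fun r => intervalIntegrable_of_continuousOn_pos (continuousOn_exp_mul_rpow r) ha0 hab
  rw [← mul_assoc, ← intervalIntegral.integral_const_mul]
  refine intervalIntegral.integral_mono_on hab ((hg _).const_mul _) (hg _) fun t ht => ?_
  have ht0 : 0 < t := ha0.trans_le ht.1
  have hc1 : c ≤ (t / (21 / 5)) ^ (p - 1 / 4) := by
    have h1 : 1 ≤ t / (21 / 5) := by
      rw [le_div_iff₀ (by norm_num)]
      linarith [ht.1]
    calc c = (c ^ 4) ^ (1 / 4 : ℝ) := by
          rw [← Real.rpow_natCast, ← Real.rpow_mul hc]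
          norm_num
      _ ≤ ((t / (21 / 5))⁻¹) ^ (1 / 4 : ℝ) := by
          refine Real.rpow_le_rpow (by positivity) ?_ (by norm_num)
          rw [inv_div, le_div_iff₀ ht0]
          have := mul_le_mul_of_nonneg_right ht.2 (by positivity : 0 ≤ c ^ 4)
          linarith
      _ = (t / (21 / 5)) ^ (-(1 / 4) : ℝ) := by
          rw [Real.inv_rpow (by positivity), Real.rpow_neg (by positivity)]
      _ ≤ _ := Real.rpow_le_rpow_of_exponent_le h1 (by linarith)
  rw [Real.div_rpow ht0.le (by norm_num), le_div_iff₀ (by positivity)] at hc1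
  rw [rpow_sub_one_eq ht0]
  calc _ = (c * (21 / 5) ^ (p - 1 / 4))
        * (Real.exp (-(0.168 * t ^ 2)) * t ^ (-(3 / 4) : ℝ)) := by ring
    _ ≤ t ^ (p - 1 / 4) * (Real.exp (-(0.168 * t ^ 2)) * t ^ (-(3 / 4) : ℝ)) := by gcongr
    _ = _ := by ring

lemma integrableOn_gaussian_mul_rpow {p : ℝ} (hp : 0 < p) :
    IntegrableOn (fun t : ℝ => Real.exp (-(0.168 * t ^ 2)) * t ^ (p - 1)) (Ioi 0) := by
  refine (integrableOn_rpow_mul_exp_neg_mul_sq (b := 0.168) (by norm_num)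
    (s := p - 1) (by linarith)).congr_fun (fun t _ => ?_) measurableSet_Ioi
  simp only [neg_mul]
  ring

lemma integral_gaussian_mul_rpow_le {p : ℝ} (hp : 0 < p) :
    ∫ t in Ioi (0 : ℝ), Real.exp (-(0.168 * t ^ 2)) * t ^ (p - 1)
      ≤ Real.exp (2 * p / 17) * Gfun p 1.7 := by
  have h := integral_rpow_mul_exp_neg_mul_rpow (p := 2) (q := p - 1) (b := 0.168)
    (by norm_num) (by linarith) (by norm_num)
  have e : ∫ t in Ioi (0 : ℝ), Real.exp (-(0.168 * t ^ 2)) * t ^ (p - 1)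
      = ∫ x in Ioi (0 : ℝ), x ^ (p - 1) * Real.exp (-0.168 * x ^ (2 : ℝ)) := by
    refine setIntegral_congr_fun measurableSet_Ioi fun t _ => ?_
    simp only [neg_mul, Real.rpow_two]
    ring
  have hG : 0 < Real.Gamma (p / 2) := Real.Gamma_pos_of_pos (by linarith)
  have hexp : 1.265 ≤ Real.exp (4 / 17) := by
    have := Real.sum_le_exp_of_nonneg (x := 4 / 17) (by norm_num) 4
    norm_num [Finset.sum_range_succ, Nat.factorial] at this ⊢
    linarith
  have hbase : (0.168 : ℝ)⁻¹ ^ (p / 2) ≤ (Real.exp (4 / 17) * (1.7 : ℝ)⁻¹ * 2 ^ (3 : ℝ)) ^ (p / 2) := by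
    refine Real.rpow_le_rpow (by norm_num) ?_ (by linarith)
    norm_num at hexp ⊢
    linarith
  rw [Real.mul_rpow (by positivity) (by positivity), Real.mul_rpow (by positivity) (by positivity),
    ← Real.exp_mul, ← Real.rpow_mul (by norm_num), Real.inv_rpow (by norm_num),
    Real.inv_rpow (by norm_num), ← Real.rpow_neg (by norm_num), ← Real.rpow_neg (by norm_num)]
    at hbase
  rw [e, h]
  unfold Gfun
  rw [show -(p - 1 + 1) / 2 = -(p / 2) by ring, show (p - 1 + 1) / 2 = p / 2 by ring,
    show -p / 2 = -(p / 2) by ring, Real.rpow_sub (by norm_num), Real.rpow_one,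
    show 3 * p / 2 = 3 * (p / 2) by ring, show 2 * p / 17 = 4 / 17 * (p / 2) by ring]
  have := mul_le_mul_of_nonneg_right hbase (by positivity : 0 ≤ Real.Gamma (p / 2) / 2)
  linarith

/-- For `0 < p ≤ 1/4`: `F(p, 1.3) < e^{2p/17} G(p, 1.7)`, where
`F(p,s) = ∫_0^∞ |𝔧₁(t)|^s t^{p-1} dt`. -/
theorem F_interp_bound_small_p (p : ℝ) (hp0 : 0 < p) (hp1 : p ≤ 1 / 4) :
    ∫⁻ t in Set.Ioi (0 : ℝ), ENNReal.ofReal (|jj1 t| ^ (1.3 : ℝ) * t ^ (p - 1))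
      < ENNReal.ofReal (Real.exp (2 * p / 17) * Gfun p 1.7) := by
  have split : ∀ {h : ℝ → ℝ} {a b : ℝ}, a ≤ b → IntegrableOn h (Ioi a) →
      ∫ t in Ioi a, h t = (∫ t in a..b, h t) + ∫ t in Ioi b, h t := fun hab hi =>
    (intervalIntegral.integral_interval_add_Ioi hi (hi.mono_set (Ioi_subset_Ioi hab))).symm
  have hf2 := integrableOn_Ioi_two_abs_jj1_rpow_mul hp1
  have hf : IntegrableOn (fun t => |jj1 t| ^ (1.3 : ℝ) * t ^ (p - 1)) (Ioi 0) := by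
    rw [← Ioc_union_Ioi_eq_Ioi (show (0 : ℝ) ≤ 2 by norm_num)]
    exact ((intervalIntegrable_iff_integrableOn_Ioc_of_le (by norm_num)).mp
      (intervalIntegrable_mul_rpow continuous_abs_jj1_rpow hp0 0 2)).union hf2
  have hg := integrableOn_gaussian_mul_rpow hp0
  have hsub : ∀ {a : ℝ}, 0 ≤ a → Ioi a ⊆ Ioi (0 : ℝ) := fun ha => Ioi_subset_Ioi ha
  have hgnn : ∀ {a : ℝ}, 0 ≤ a →
      0 ≤ ∫ t in Ioi a, Real.exp (-(0.168 * t ^ 2)) * t ^ (p - 1) := fun ha =>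
    setIntegral_nonneg measurableSet_Ioi fun t ht => by
      have : 0 < t := hsub ha ht
      positivity
  rw [← ofReal_integral_eq_lintegral_ofReal hf
    ((ae_restrict_iff' measurableSet_Ioi).mpr (Filter.Eventually.of_forall fun t ht => by
      have : (0 : ℝ) < t := ht
      positivity))]
  have hlt : ∫ t in Ioi (0 : ℝ), |jj1 t| ^ (1.3 : ℝ) * t ^ (p - 1)
      < ∫ t in Ioi (0 : ℝ), Real.exp (-(0.168 * t ^ 2)) * t ^ (p - 1) := by
    have hg42 : IntegrableOn (fun t : ℝ => Real.exp (-(0.168 * t ^ 2)) * t ^ (p - 1))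
      (Ioi (21 / 5)) := hg.mono_set (hsub (by norm_num))
    rw [split (show (0 : ℝ) ≤ 2 by norm_num) hf, split (show (0 : ℝ) ≤ 2 by norm_num) hg,
      split (show (2 : ℝ) ≤ 21 / 5 by norm_num) hf2,
      split (show (2 : ℝ) ≤ 21 / 5 by norm_num) (hg.mono_set (hsub (by norm_num))),
      split (show (21 / 5 : ℝ) ≤ 24 / 5 by norm_num) hg42,
      split (show (24 / 5 : ℝ) ≤ 28 / 5 by norm_num) (hg.mono_set (hsub (by norm_num)))]
    have h1 := integral_zero_two_le hp0
    have h2 := integral_two_sub_le hp0 hp1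
    have h3 := integral_Ioi_abs_jj1_rpow_mul_le hp1
    have h4 := mul_integral_gaussian_le (a := 21 / 5) (b := 24 / 5) (c := 0.967) le_rfl
      (by norm_num) (by norm_num) (by norm_num) hp0 hp1
    have h5 := mul_integral_gaussian_le (a := 24 / 5) (b := 28 / 5) (c := 0.93) (by norm_num)
      (by norm_num) (by norm_num) (by norm_num) hp0 hp1
    have h6 := hgnn (show (0 : ℝ) ≤ 28 / 5 by norm_num)
    have h7 := integral_Ioi_abs_jj1_rpow_le.trans_lt integral_abs_jj1_rpow_lt_gaussian
    rw [split (show (2 : ℝ) ≤ 21 / 5 by norm_num) integrableOn_abs_jj1_rpow] at h7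
    have h8 := mul_lt_mul_of_pos_left h7
      (Real.rpow_pos_of_pos (show (0 : ℝ) < 21 / 5 by norm_num) (p - 1 / 4))
    linarith
  have hlt' := hlt.trans_le (integral_gaussian_mul_rpow_le hp0)
  exact (ENNReal.ofReal_lt_ofReal_iff ((hgnn le_rfl |>.trans
    (integral_gaussian_mul_rpow_le hp0)).lt_of_ne' (by
      have h9 : 0 ≤ ∫ t in Ioi (0 : ℝ), |jj1 t| ^ (1.3 : ℝ) * t ^ (p - 1) :=
        setIntegral_nonneg measurableSet_Ioi fun t ht => by
          have : (0 : ℝ) < t := ht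
          positivity
      exact (h9.trans_lt hlt').ne'))).mpr hlt'
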